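/- arXiv:1304.4724 — 6 statements merged into one kernel-verified Lean document; each statement's English description precedes it below -/
import Mathlib

section
/- Let (X,d) be a metric space and let A and B be nonempty subsets of X such that A is compact and B is approximatively compact with respect to A. Then the sets A⁰ := {x ∈ A : d(x,y) = d(A,B) for some y ∈ B} and B⁰ := {y ∈ B : d(x,y) = d(A,B) for some x ∈ A} are both nonempty. -/
open Filter

/-- The inf distance between two sets: `d(A,B) = inf {d(a,b) : a ∈ A, b ∈ B}`. -/
noncomputable def setDist {X : Type*} [MetricSpace X] (A B : Set X) : ℝ :=
  sInf (Set.image2 dist A B)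

/-- `B` is approximatively compact with respect to `A`: for every `y ∈ A`,
every sequence in `B` whose distances to `y` tend to `d(y,B)` has a
subsequence converging to an element of `B`. -/
def ApproxCompactWrt {X : Type*} [MetricSpace X] (B A : Set X) : Prop :=
  ∀ y ∈ A, ∀ x : ℕ → X, (∀ n, x n ∈ B) →
    Tendsto (fun n => dist y (x n)) atTop (nhds (Metric.infDist y B)) →
    ∃ z ∈ B, ∃ φ : ℕ → ℕ, StrictMono φ ∧ Tendsto (x ∘ φ) atTop (nhds z)

/-- If `B` is approximatively compact with respect to `A`, every point of `A` has a
nearest point in `B`. -/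
theorem ApproxCompactWrt.exists_dist_eq_infDist {X : Type*} [MetricSpace X] {A B : Set X}
    (hB : ApproxCompactWrt B A) (hBne : B.Nonempty) {x : X} (hx : x ∈ A) :
    ∃ y ∈ B, dist x y = Metric.infDist x B := by
  have hseq : ∀ n : ℕ, ∃ y ∈ B, dist x y < Metric.infDist x B + 1 / ((n : ℝ) + 1) := fun n =>
    (Metric.infDist_lt_iff hBne).1 (lt_add_of_pos_right _ Nat.one_div_pos_of_nat)
  choose u huB hu using hseq
  have hlim : Tendsto (fun n => dist x (u n)) atTop (nhds (Metric.infDist x B)) := by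
    refine tendsto_of_tendsto_of_tendsto_of_le_of_le tendsto_const_nhds ?_
      (fun n => Metric.infDist_le_dist_of_mem (huB n)) (fun n => (hu n).le)
    simpa using (tendsto_one_div_add_atTop_nhds_zero_nat (𝕜 := ℝ)).const_add (Metric.infDist x B)
  obtain ⟨z, hz, φ, hφ, hφz⟩ := hB x hx u huB hlim
  exact ⟨z, hz, tendsto_nhds_unique (tendsto_const_nhds.dist hφz) (hlim.comp hφ.tendsto_atTop)⟩

/-- Result 1 (Eldred–Veeramani): if `A` is compact and `B` is approximatively
compact with respect to `A`, then the sets `A⁰` and `B⁰` of best proximity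
points are nonempty. -/
theorem stmt_10 {X : Type*} [MetricSpace X] (A B : Set X)
    (hAne : A.Nonempty) (hBne : B.Nonempty)
    (hA : IsCompact A) (hB : ApproxCompactWrt B A) :
    {x ∈ A | ∃ y ∈ B, dist x y = setDist A B}.Nonempty ∧
    {y ∈ B | ∃ x ∈ A, dist x y = setDist A B}.Nonempty := by
  obtain ⟨x, hx, hmin⟩ := hA.exists_isMinOn hAne (Metric.continuous_infDist_pt B).continuousOn
  obtain ⟨y, hy, hxy⟩ := hB.exists_dist_eq_infDist hBne hx
  have hleast : IsLeast (Set.image2 dist A B) (dist x y) := by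
    refine ⟨⟨x, hx, y, hy, rfl⟩, ?_⟩
    rintro _ ⟨a, ha, b, hb, rfl⟩
    exact hxy.trans_le ((hmin ha).trans (Metric.infDist_le_dist_of_mem hb))
  have hdist : dist x y = setDist A B := hleast.csInf_eq.symm
  exact ⟨⟨x, hx, y, hy, hdist⟩, ⟨y, hy, x, hx, hdist⟩⟩
end

section
/- Let X be a reflexive (real) Banach space, let A be a nonempty, closed, bounded and convex subset of X, and let B be a nonempty, closed and convex subset of X. Then the sets A⁰ := {x ∈ A : ‖x − y‖ = d(A,B) for some y ∈ B} and B⁰ := {y ∈ B : ‖x − y‖ = d(A,B) for some x ∈ A} are both nonempty. -/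
open NormedSpace in
/-- In a reflexive space, bounded closed convex sets are weakly compact. -/
theorem Convex.isCompact_image_toWeakSpace {X : Type*} [NormedAddCommGroup X] [NormedSpace ℝ X]
    (hrefl : Function.Surjective (inclusionInDoubleDual ℝ X)) {s : Set X} (hs : Convex ℝ s)
    (hcl : IsClosed s) (hbd : Bornology.IsBounded s) : IsCompact (toWeakSpace ℝ X '' s) := by
  have hcl' : closure (toWeakSpace ℝ X '' s) = toWeakSpace ℝ X '' s := by
    rw [← hs.toWeakSpace_closure ℝ, hcl.closure_eq]
  rw [← hcl']
  refine isCompact_closure_of_isBounded ℝ X _ ?_ fun φ _ => ?_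
  · rwa [Set.preimage_image_eq _ (toWeakSpace ℝ X).injective]
  · obtain ⟨x, hx⟩ := hrefl (WeakDual.toStrongDual φ)
    exact ⟨toWeakSpace ℝ X x, congrArg StrongDual.toWeakDual hx⟩

/-- The norm is weakly lower semicontinuous. -/
theorem WeakSpace.lowerSemicontinuous_norm {X : Type*} [NormedAddCommGroup X] [NormedSpace ℝ X] :
    LowerSemicontinuous fun x : WeakSpace ℝ X => ‖(toWeakSpace ℝ X).symm x‖ := by
  rw [lowerSemicontinuous_iff_isClosed_preimage]
  intro r
  have h : (fun x : WeakSpace ℝ X => ‖(toWeakSpace ℝ X).symm x‖) ⁻¹' Set.Iic r =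
      toWeakSpace ℝ X '' Metric.closedBall 0 r := by
    ext x
    rw [LinearEquiv.image_eq_preimage_symm]
    simp
  rw [h, ← Metric.isClosed_closedBall.closure_eq,
    (convex_closedBall (0 : X) r).toWeakSpace_closure ℝ]
  exact isClosed_closure

/-- In a reflexive space, the distance between two bounded closed convex sets is attained. -/
theorem exists_forall_norm_sub_le_of_isBounded {X : Type*} [NormedAddCommGroup X]
    [NormedSpace ℝ X] (hrefl : Function.Surjective (NormedSpace.inclusionInDoubleDual ℝ X))
    {A B : Set X} (hAne : A.Nonempty) (hBne : B.Nonempty)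
    (hAcl : IsClosed A) (hAbd : Bornology.IsBounded A) (hAcv : Convex ℝ A)
    (hBcl : IsClosed B) (hBbd : Bornology.IsBounded B) (hBcv : Convex ℝ B) :
    ∃ x ∈ A, ∃ y ∈ B, ∀ a ∈ A, ∀ b ∈ B, ‖x - y‖ ≤ ‖a - b‖ := by
  have hK := (hAcv.isCompact_image_toWeakSpace hrefl hAcl hAbd).prod
    (hBcv.isCompact_image_toWeakSpace hrefl hBcl hBbd)
  have hf : LowerSemicontinuous fun p : WeakSpace ℝ X × WeakSpace ℝ X =>
      ‖(toWeakSpace ℝ X).symm (p.1 - p.2)‖ :=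
    WeakSpace.lowerSemicontinuous_norm.comp (continuous_fst.sub continuous_snd)
  obtain ⟨⟨_, _⟩, ⟨⟨x, hx, rfl⟩, ⟨y, hy, rfl⟩⟩, hmin⟩ :=
    (hf.lowerSemicontinuousOn _).exists_isMinOn ((hAne.image _).prod (hBne.image _)) hK
  refine ⟨x, hx, y, hy, fun a ha b hb => ?_⟩
  simpa using isMinOn_iff.1 hmin (toWeakSpace ℝ X a, toWeakSpace ℝ X b)
    ⟨Set.mem_image_of_mem _ ha, Set.mem_image_of_mem _ hb⟩

/-- In a reflexive space, the distance between two closed convex sets, one of which is bounded,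
is attained. -/
theorem exists_forall_norm_sub_le {X : Type*} [NormedAddCommGroup X]
    [NormedSpace ℝ X] (hrefl : Function.Surjective (NormedSpace.inclusionInDoubleDual ℝ X))
    {A B : Set X} (hAne : A.Nonempty) (hBne : B.Nonempty)
    (hAcl : IsClosed A) (hAbd : Bornology.IsBounded A) (hAcv : Convex ℝ A)
    (hBcl : IsClosed B) (hBcv : Convex ℝ B) :
    ∃ x ∈ A, ∃ y ∈ B, ∀ a ∈ A, ∀ b ∈ B, ‖x - y‖ ≤ ‖a - b‖ := by
  obtain ⟨a₀, ha₀⟩ := hAne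
  obtain ⟨b₀, hb₀⟩ := hBne
  obtain ⟨r, hr⟩ := hAbd.exists_norm_le
  have hb₀' : b₀ ∈ B ∩ Metric.closedBall 0 (r + ‖a₀ - b₀‖) := by
    refine ⟨hb₀, mem_closedBall_zero_iff.2 ?_⟩
    linarith [hr a₀ ha₀, norm_le_norm_add_norm_sub a₀ b₀]
  obtain ⟨x, hx, y, hy, hmin⟩ := exists_forall_norm_sub_le_of_isBounded hrefl ⟨a₀, ha₀⟩
    ⟨b₀, hb₀'⟩ hAcl hAbd hAcv (hBcl.inter Metric.isClosed_closedBall)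
    (Metric.isBounded_closedBall.subset Set.inter_subset_right)
    (hBcv.inter (convex_closedBall _ _))
  refine ⟨x, hx, y, hy.1, fun a ha b hb => ?_⟩
  by_cases hbR : ‖b‖ ≤ r + ‖a₀ - b₀‖
  · exact hmin a ha b ⟨hb, mem_closedBall_zero_iff.2 hbR⟩
  · linarith [hmin a₀ ha₀ b₀ hb₀', hr a ha, norm_le_norm_add_norm_sub a b]


/-- Result 2 (Eldred–Veeramani): in a reflexive real Banach space, if `A` is
nonempty, closed, bounded and convex and `B` is nonempty, closed and convex,
then the sets `A⁰` and `B⁰` of best proximity points are nonempty.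
Reflexivity is expressed as surjectivity of the canonical inclusion of `X`
into its double dual. -/
theorem stmt_11 {X : Type*} [NormedAddCommGroup X] [NormedSpace ℝ X] [CompleteSpace X]
    (hrefl : Function.Surjective (NormedSpace.inclusionInDoubleDual ℝ X))
    (A B : Set X) (hAne : A.Nonempty) (hBne : B.Nonempty)
    (hAcl : IsClosed A) (hAbd : Bornology.IsBounded A) (hAcv : Convex ℝ A)
    (hBcl : IsClosed B) (hBcv : Convex ℝ B) :
    {x ∈ A | ∃ y ∈ B, ‖x - y‖ = sInf (Set.image2 (fun a b => ‖a - b‖) A B)}.Nonempty ∧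
    {y ∈ B | ∃ x ∈ A, ‖x - y‖ = sInf (Set.image2 (fun a b => ‖a - b‖) A B)}.Nonempty := by
  obtain ⟨x, hx, y, hy, hmin⟩ :=
    exists_forall_norm_sub_le hrefl hAne hBne hAcl hAbd hAcv hBcl hBcv
  have hleast : IsLeast (Set.image2 (fun a b => ‖a - b‖) A B) ‖x - y‖ :=
    ⟨Set.mem_image2_of_mem hx hy, Set.forall_mem_image2.2 hmin⟩
  exact ⟨⟨x, hx, y, hy, hleast.csInf_eq.symm⟩, ⟨y, hy, x, hx, hleast.csInf_eq.symm⟩⟩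
end

section
/- Let (X,d) be a metric space, let A and B be nonempty closed subsets of X, and let T : A ∪ B → A ∪ B be a 2-cyclic contraction, i.e. T(A) ⊆ B, T(B) ⊆ A, and there exists k ∈ [0,1) with d(Tx,Ty) ≤ k·d(x,y) + (1−k)·d(A,B) for all x ∈ A, y ∈ B. If A is boundedly compact or B is boundedly compact, then there exists x ∈ A ∪ B such that d(x,Tx) = d(A,B). -/
open Filter

/-- `A` is boundedly compact: every bounded sequence in `A` has a subsequence
converging to a point of `A`. -/
def BoundedlyCompact {X : Type*} [MetricSpace X] (A : Set X) : Prop :=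
  ∀ x : ℕ → X, (∀ n, x n ∈ A) → Bornology.IsBounded (Set.range x) →
    ∃ z ∈ A, ∃ φ : ℕ → ℕ, StrictMono φ ∧ Tendsto (x ∘ φ) atTop (nhds z)

theorem setDist_comm {X : Type*} [MetricSpace X] (A B : Set X) : setDist A B = setDist B A := by
  unfold setDist
  rw [Set.image2_swap]
  simp only [dist_comm]

theorem setDist_le_dist {X : Type*} [MetricSpace X] {A B : Set X} {a b : X}
    (ha : a ∈ A) (hb : b ∈ B) : setDist A B ≤ dist a b := by
  refine csInf_le ⟨0, ?_⟩ (Set.mem_image2_of_mem ha hb)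
  rintro _ ⟨x, -, y, -, rfl⟩
  exact dist_nonneg

theorem iterate_two_mul_mem {X : Type*} {A B : Set X} {T : X → X}
    (hTA : Set.MapsTo T A B) (hTB : Set.MapsTo T B A) {x : X} (hx : x ∈ A) (n : ℕ) :
    T^[2 * n] x ∈ A := by
  rw [Function.iterate_mul]
  exact (hTB.comp hTA).iterate n hx

section CyclicContraction

variable {X : Type*} [MetricSpace X] {A B : Set X} {T : X → X} {k : ℝ}

theorem dist_iterate_sub_setDist_le (hTA : Set.MapsTo T A B) (hTB : Set.MapsTo T B A) (hk0 : 0 ≤ k)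
    (hcontr : ∀ x ∈ A, ∀ y ∈ B, dist (T x) (T y) ≤ k * dist x y + (1 - k) * setDist A B)
    (n : ℕ) {x y : X} (hxy : x ∈ A ∧ y ∈ B ∨ x ∈ B ∧ y ∈ A) :
    dist (T^[n] x) (T^[n] y) - setDist A B ≤ k ^ n * (dist x y - setDist A B) := by
  induction n generalizing x y with
  | zero => simp
  | succ n ih =>
    have hstep : dist (T x) (T y) - setDist A B ≤ k * (dist x y - setDist A B) := by
      rcases hxy with ⟨hx, hy⟩ | ⟨hx, hy⟩
      · linarith [hcontr x hx y hy]
      · rw [dist_comm (T x), dist_comm x]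
        linarith [hcontr y hy x hx]
    have hT : T x ∈ A ∧ T y ∈ B ∨ T x ∈ B ∧ T y ∈ A :=
      hxy.symm.imp (fun h => ⟨hTB h.1, hTA h.2⟩) (fun h => ⟨hTA h.1, hTB h.2⟩)
    calc dist (T^[n] (T x)) (T^[n] (T y)) - setDist A B
        ≤ k ^ n * (dist (T x) (T y) - setDist A B) := ih hT
      _ ≤ k ^ n * (k * (dist x y - setDist A B)) := by gcongr
      _ = k ^ (n + 1) * (dist x y - setDist A B) := by ring

theorem tendsto_dist_iterate_succ (hTA : Set.MapsTo T A B) (hTB : Set.MapsTo T B A)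
    (hk0 : 0 ≤ k) (hk1 : k < 1)
    (hcontr : ∀ x ∈ A, ∀ y ∈ B, dist (T x) (T y) ≤ k * dist x y + (1 - k) * setDist A B)
    {x : X} (hx : x ∈ A) :
    Tendsto (fun n => dist (T^[n] x) (T^[n + 1] x)) atTop (nhds (setDist A B)) := by
  have hmem (n : ℕ) : T^[n] x ∈ A ∧ T^[n + 1] x ∈ B ∨ T^[n] x ∈ B ∧ T^[n + 1] x ∈ A := by
    induction n with
    | zero => exact Or.inl ⟨hx, hTA hx⟩
    | succ n ih =>
      rw [Function.iterate_succ_apply' T (n + 1)]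
      exact ih.symm.imp (fun h => ⟨h.2, hTA h.2⟩) (fun h => ⟨h.2, hTB h.2⟩)
  refine tendsto_of_tendsto_of_tendsto_of_le_of_le (tendsto_const_nhds (x := setDist A B))
    (h := fun n => setDist A B + k ^ n * (dist x (T x) - setDist A B)) ?_ (fun n => ?_)
    (fun n => ?_)
  · simpa using ((tendsto_pow_atTop_nhds_zero_of_lt_one hk0 hk1).mul_const
      (dist x (T x) - setDist A B)).const_add (setDist A B)
  · rcases hmem n with h | h
    · exact setDist_le_dist h.1 h.2
    · rw [setDist_comm]
      exact setDist_le_dist h.1 h.2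
  · have := dist_iterate_sub_setDist_le hTA hTB hk0 hcontr n (Or.inl ⟨hx, hTA hx⟩)
    simp only [Function.iterate_succ_apply]
    linarith

theorem dist_iterate_two_mul_le (hTA : Set.MapsTo T A B) (hTB : Set.MapsTo T B A)
    (hk0 : 0 ≤ k) (hk1 : k < 1)
    (hcontr : ∀ x ∈ A, ∀ y ∈ B, dist (T x) (T y) ≤ k * dist x y + (1 - k) * setDist A B)
    {x : X} (hx : x ∈ A) (n : ℕ) :
    dist (T^[2 * n] x) (T x) ≤ dist x (T x) + 2 * k * dist x (T x) / (1 - k) := by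
  have h1k : 0 < 1 - k := sub_pos.2 hk1
  have hD : setDist A B ≤ dist x (T x) := setDist_le_dist hx (hTA hx)
  induction n with
  | zero =>
    have : 0 ≤ 2 * k * dist x (T x) / (1 - k) := by positivity
    simpa using this
  | succ n ih =>
    have hmem := iterate_two_mul_mem hTA hTB hx n
    have hc := hcontr x hx _ (hTA hmem)
    have hstep : dist (T^[2 * n] x) (T (T^[2 * n] x)) ≤ dist x (T x) := by
      have h := dist_iterate_sub_setDist_le hTA hTB hk0 hcontr (2 * n) (Or.inl ⟨hx, hTA hx⟩)
      rw [← Function.iterate_succ_apply, Function.iterate_succ_apply'] at h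
      have := mul_le_of_le_one_left (sub_nonneg.2 hD) (pow_le_one₀ (n := 2 * n) hk0 hk1.le)
      linarith
    have htri : dist x (T (T^[2 * n] x)) ≤
        dist x (T x) + dist (T^[2 * n] x) (T x) + dist (T^[2 * n] x) (T (T^[2 * n] x)) := by
      have := dist_triangle4 x (T x) (T^[2 * n] x) (T (T^[2 * n] x))
      rwa [dist_comm (T x)] at this
    have hk : k * dist x (T (T^[2 * n] x)) ≤
        k * (3 * dist x (T x) + 2 * k * dist x (T x) / (1 - k)) := by
      gcongr
      linarith
    have hDk := mul_le_mul_of_nonneg_left hD h1k.le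
    have hfix : 2 * k * dist x (T x) / (1 - k) =
        2 * k * dist x (T x) + k * (2 * k * dist x (T x) / (1 - k)) := by
      field_simp
      ring
    rw [show 2 * (n + 1) = 2 * n + 1 + 1 by ring, Function.iterate_succ_apply',
      Function.iterate_succ_apply', dist_comm]
    linarith

theorem exists_dist_eq_setDist_of_boundedlyCompact (hAne : A.Nonempty)
    (hTA : Set.MapsTo T A B) (hTB : Set.MapsTo T B A) (hk0 : 0 ≤ k) (hk1 : k < 1)
    (hcontr : ∀ x ∈ A, ∀ y ∈ B, dist (T x) (T y) ≤ k * dist x y + (1 - k) * setDist A B)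
    (hA : BoundedlyCompact A) : ∃ x ∈ A, dist x (T x) = setDist A B := by
  obtain ⟨x, hx⟩ := hAne
  have hmem := iterate_two_mul_mem hTA hTB hx
  have hbdd : Bornology.IsBounded (Set.range fun n => T^[2 * (n + 1)] x) := by
    refine (Metric.isBounded_iff_subset_closedBall (T x)).2
      ⟨dist x (T x) + 2 * k * dist x (T x) / (1 - k), Set.range_subset_iff.2 fun n => ?_⟩
    exact dist_iterate_two_mul_le hTA hTB hk0 hk1 hcontr hx (n + 1)
  obtain ⟨z, hz, φ, hφ, hlim⟩ := hA _ (fun n => hmem (n + 1)) hbdd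
  refine ⟨z, hz, le_antisymm ?_ (setDist_le_dist hz (hTA hz))⟩
  have hzlim : Tendsto (fun n => dist z (T^[2 * (φ n + 1)] x)) atTop (nhds 0) := by
    simpa using (tendsto_const_nhds (x := z)).dist hlim
  have hgap : Tendsto (fun n => dist (T^[2 * φ n + 1] x) (T^[2 * (φ n + 1)] x)) atTop
      (nhds (setDist A B)) :=
    (tendsto_dist_iterate_succ hTA hTB hk0 hk1 hcontr hx).comp <|
      tendsto_atTop_mono (fun n => show n ≤ 2 * φ n + 1 by have := hφ.le_apply (x := n); omega)
        tendsto_id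
  have hbound := (hzlim.add ((hzlim.add hgap).const_mul k)).add_const ((1 - k) * setDist A B)
  rw [show 0 + k * (0 + setDist A B) + (1 - k) * setDist A B = setDist A B by ring] at hbound
  refine ge_of_tendsto' hbound fun n => ?_
  have hw : T^[2 * φ n + 1] x ∈ B := by
    rw [Function.iterate_succ_apply']
    exact hTA (hmem _)
  have hc := hcontr z hz _ hw
  rw [← Function.iterate_succ_apply' T, show (2 * φ n + 1).succ = 2 * (φ n + 1) from rfl] at hc
  have htri := dist_triangle_right z (T^[2 * φ n + 1] x) (T^[2 * (φ n + 1)] x)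
  have htri' := dist_triangle_right z (T z) (T^[2 * (φ n + 1)] x)
  have := mul_le_mul_of_nonneg_left htri hk0
  linarith

end CyclicContraction

/-- Result 3 (Eldred–Veeramani): if `T` is a 2-cyclic contraction on `A ∪ B`
with `A`, `B` nonempty closed, and `A` or `B` is boundedly compact, then some
`x ∈ A ∪ B` satisfies `d(x, Tx) = d(A,B)`. -/
theorem stmt_12 {X : Type*} [MetricSpace X] (A B : Set X)
    (hAne : A.Nonempty) (hBne : B.Nonempty) (hAcl : IsClosed A) (hBcl : IsClosed B)
    (T : X → X) (hTA : Set.MapsTo T A B) (hTB : Set.MapsTo T B A)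
    (k : ℝ) (hk0 : 0 ≤ k) (hk1 : k < 1)
    (hcontr : ∀ x ∈ A, ∀ y ∈ B, dist (T x) (T y) ≤ k * dist x y + (1 - k) * setDist A B)
    (hcpt : BoundedlyCompact A ∨ BoundedlyCompact B) :
    ∃ x ∈ A ∪ B, dist x (T x) = setDist A B := by
  rcases hcpt with hA | hB
  · obtain ⟨x, hx, h⟩ :=
      exists_dist_eq_setDist_of_boundedlyCompact hAne hTA hTB hk0 hk1 hcontr hA
    exact ⟨x, Or.inl hx, h⟩
  · obtain ⟨x, hx, h⟩ := exists_dist_eq_setDist_of_boundedlyCompact hBne hTB hTA hk0 hk1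
      (fun x hx y hy => by
        rw [dist_comm (T x), dist_comm x, setDist_comm]
        exact hcontr y hy x hx) hB
    exact ⟨x, Or.inr hx, h.trans (setDist_comm B A)⟩
end

section
/- Let X be a uniformly convex (real) Banach space, let A be a nonempty closed convex subset of X, and let B be a nonempty closed subset of X, with D := d(A,B). Let (x_n) and (z_n) be sequences in A and (y_n) a sequence in B such that ‖x_n − y_n‖ → D and ‖z_n − y_n‖ → D as n → ∞. Then ‖z_n − x_n‖ → 0 as n → ∞. -/
open Filter

/-- In a uniformly convex space, if the norms of `u` and `v` converge to `r` and the norm of `u + v`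
is at least `2 * r`, then `u - v` converges to zero in norm. -/
theorem UniformConvexSpace.tendsto_norm_sub_of_two_mul_le_norm_add {ι E : Type*}
    [SeminormedAddCommGroup E] [NormedSpace ℝ E] [UniformConvexSpace E] {l : Filter ι} [l.NeBot]
    {u v : ι → E} {r : ℝ} (hu : Tendsto (fun i => ‖u i‖) l (nhds r))
    (hv : Tendsto (fun i => ‖v i‖) l (nhds r)) (huv : ∀ᶠ i in l, 2 * r ≤ ‖u i + v i‖) :
    Tendsto (fun i => ‖u i - v i‖) l (nhds 0) := by
  have hr : 0 ≤ r := ge_of_tendsto' hu fun _ => norm_nonneg _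
  obtain rfl | hr := hr.eq_or_lt
  · exact squeeze_zero (fun _ => norm_nonneg _) (fun _ => norm_sub_le _ _)
      (by simpa using hu.add hv)
  rw [Metric.tendsto_nhds]
  intro ε hε
  obtain ⟨δ, hδ, h⟩ := exists_forall_closed_ball_dist_add_le_two_sub E
    (show 0 < ε / (r + 1) by positivity)
  obtain ⟨s, hs, hs1, hsδ⟩ : ∃ s, r < s ∧ s ≤ r + 1 ∧ (2 - δ) * s < 2 * r := by
    refine ⟨r + min 1 (δ * r / 4), by simp [hδ, hr], by simp, ?_⟩
    have hη : 0 < min 1 (δ * r / 4) := by simp [hδ, hr]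
    nlinarith [min_le_right 1 (δ * r / 4), mul_pos hδ hr, mul_pos hδ hη]
  have hs0 : 0 < s := hr.trans hs
  filter_upwards [hu.eventually_lt_const hs, hv.eventually_lt_const hs, huv] with i hui hvi hi
  rw [Real.dist_0_eq_abs, abs_norm]
  by_contra! hge
  have norm_inv_smul (w : E) : ‖s⁻¹ • w‖ = ‖w‖ / s := by
    rw [norm_smul_of_nonneg (by positivity), inv_mul_eq_div]
  have hle := h (x := s⁻¹ • u i) (y := s⁻¹ • v i)
    (by rw [norm_inv_smul, div_le_one hs0]; exact hui.le)
    (by rw [norm_inv_smul, div_le_one hs0]; exact hvi.le)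
    (by rw [← smul_sub, norm_inv_smul]; gcongr)
  rw [← smul_add, norm_inv_smul, div_le_iff₀ hs0] at hle
  linarith

/-- Result 4 (Eldred–Veeramani convexity lemma): in a uniformly convex real
Banach space, if `A` is nonempty closed convex, `B` is nonempty closed,
`D = d(A,B)`, and sequences `(x_n), (z_n) ⊆ A`, `(y_n) ⊆ B` satisfy
`‖x_n - y_n‖ → D` and `‖z_n - y_n‖ → D`, then `‖z_n - x_n‖ → 0`. -/
theorem stmt_13 {X : Type*} [NormedAddCommGroup X] [NormedSpace ℝ X]
    [UniformConvexSpace X] [CompleteSpace X]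
    (A B : Set X) (hAne : A.Nonempty) (hBne : B.Nonempty)
    (hAcl : IsClosed A) (hAcv : Convex ℝ A) (hBcl : IsClosed B)
    (D : ℝ) (hD : D = sInf (Set.image2 (fun a b => ‖a - b‖) A B))
    (x z : ℕ → X) (y : ℕ → X)
    (hx : ∀ n, x n ∈ A) (hz : ∀ n, z n ∈ A) (hy : ∀ n, y n ∈ B)
    (hxy : Tendsto (fun n => ‖x n - y n‖) atTop (nhds D))
    (hzy : Tendsto (fun n => ‖z n - y n‖) atTop (nhds D)) :
    Tendsto (fun n => ‖z n - x n‖) atTop (nhds 0) := by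
  have hle {a b : X} (ha : a ∈ A) (hb : b ∈ B) : D ≤ ‖a - b‖ := by
    rw [hD]
    refine csInf_le ⟨0, ?_⟩ (Set.mem_image2_of_mem ha hb)
    rintro _ ⟨a, -, b, -, rfl⟩
    exact norm_nonneg _
  have hmid (n : ℕ) : 2 * D ≤ ‖(z n - y n) + (x n - y n)‖ := by
    have hm := hle (hAcv.midpoint_mem (hz n) (hx n)) (hy n)
    have heq : (z n - y n) + (x n - y n) = (2 : ℝ) • (midpoint ℝ (z n) (x n) - y n) := by
      rw [smul_sub, two_smul, midpoint_add_self, two_smul]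
      abel
    rw [heq, norm_smul_of_nonneg zero_le_two]
    gcongr
  simpa using UniformConvexSpace.tendsto_norm_sub_of_two_mul_le_norm_add hzy hxy (.of_forall hmid)
end

section
/- Let (X,d) be a complete metric space, let A and B be nonempty closed subsets of X, and let T : A ∪ B → A ∪ B be a 2-cyclic contraction, i.e. T(A) ⊆ B, T(B) ⊆ A, and there exists k ∈ [0,1) with d(Tx,Ty) ≤ k·d(x,y) + (1−k)·d(A,B) for all x ∈ A, y ∈ B. Let x₀ ∈ A and define x_{n+1} = T x_n for all n ≥ 0. If the subsequence (x_{2n}) has a subsequence converging to a point of A, then there exists x ∈ A ∪ B such that d(x,Tx) = d(A,B). -/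
open Filter

/-- The distance between consecutive iterates of a 2-cyclic contraction tends to `d(A,B)`. -/
theorem tendsto_dist_succ_setDist {X : Type*} [MetricSpace X] {A B : Set X} {T : X → X}
    {k : ℝ} (hk0 : 0 ≤ k) (hk1 : k < 1)
    (hcontr : ∀ x ∈ A, ∀ y ∈ B, dist (T x) (T y) ≤ k * dist x y + (1 - k) * setDist A B)
    {x : ℕ → X} (hxrec : ∀ n, x (n + 1) = T (x n))
    (hxA : ∀ n, x (2 * n) ∈ A) (hxB : ∀ n, x (2 * n + 1) ∈ B) :
    Tendsto (fun n => dist (x n) (x (n + 1))) atTop (nhds (setDist A B)) := by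
  have hstep (n : ℕ) : setDist A B ≤ dist (x n) (x (n + 1)) ∧
      dist (x (n + 1)) (x (n + 2)) ≤
        k * dist (x n) (x (n + 1)) + (1 - k) * setDist A B := by
    obtain ⟨m, rfl | rfl⟩ := n.even_or_odd'
    · have h := hcontr _ (hxA m) _ (hxB m)
      rw [← hxrec, ← hxrec] at h
      exact ⟨setDist_le_dist (hxA m) (hxB m), h⟩
    · have h := hcontr _ (hxA (m + 1)) _ (hxB m)
      rw [← hxrec, ← hxrec, dist_comm, dist_comm (x (2 * (m + 1)))] at h
      exact ⟨dist_comm (x (2 * (m + 1))) _ ▸ setDist_le_dist (hxA (m + 1)) (hxB m), h⟩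
  have hbound (n : ℕ) : dist (x n) (x (n + 1)) ≤
      k ^ n * (dist (x 0) (x 1) - setDist A B) + setDist A B := by
    induction n with
    | zero => simp
    | succ n ih =>
      have := mul_le_mul_of_nonneg_left ih hk0
      rw [pow_succ']
      linarith [(hstep n).2]
  refine tendsto_of_tendsto_of_tendsto_of_le_of_le tendsto_const_nhds ?_
    (fun n => (hstep n).1) hbound
  simpa using ((tendsto_pow_atTop_nhds_zero_of_lt_one hk0 hk1).mul_const
    (dist (x 0) (x 1) - setDist A B)).add_const (setDist A B)

/-- Result 5 (Eldred–Veeramani): let `T` be a 2-cyclic contraction on `A ∪ B`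
in a complete metric space, with `A`, `B` nonempty closed, `x₀ ∈ A` and
`x_{n+1} = T x_n`. If `(x_{2n})` has a subsequence converging to a point of
`A`, then some `x ∈ A ∪ B` satisfies `d(x, Tx) = d(A,B)`. -/
theorem stmt_14 {X : Type*} [MetricSpace X] [CompleteSpace X] (A B : Set X)
    (hAne : A.Nonempty) (hBne : B.Nonempty) (hAcl : IsClosed A) (hBcl : IsClosed B)
    (T : X → X) (hTA : Set.MapsTo T A B) (hTB : Set.MapsTo T B A)
    (k : ℝ) (hk0 : 0 ≤ k) (hk1 : k < 1)
    (hcontr : ∀ x ∈ A, ∀ y ∈ B, dist (T x) (T y) ≤ k * dist x y + (1 - k) * setDist A B)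
    (x : ℕ → X) (hx0 : x 0 ∈ A) (hxrec : ∀ n, x (n + 1) = T (x n))
    (hsub : ∃ z ∈ A, ∃ φ : ℕ → ℕ, StrictMono φ ∧
      Tendsto (fun j => x (2 * φ j)) atTop (nhds z)) :
    ∃ y ∈ A ∪ B, dist y (T y) = setDist A B := by
  obtain ⟨z, hz, φ, hφ, hlim⟩ := hsub
  have hxA (n : ℕ) : x (2 * n) ∈ A := by
    induction n with
    | zero => exact hx0
    | succ n ih =>
      rw [show 2 * (n + 1) = 2 * n + 1 + 1 by ring, hxrec, hxrec]
      exact hTB (hTA ih)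
  have hxB (n : ℕ) : x (2 * n + 1) ∈ B := hxrec (2 * n) ▸ hTA (hxA n)
  have hcons := tendsto_dist_succ_setDist hk0 hk1 hcontr hxrec hxA hxB
  refine ⟨z, Or.inl hz, le_antisymm ?_ (setDist_le_dist hz (hTA hz))⟩
  have hidx : Tendsto (fun j => 2 * φ j - 1) atTop atTop :=
    tendsto_atTop_mono (fun j => by have := hφ.le_apply (x := j); omega) (tendsto_sub_atTop_nat 1)
  have hd := tendsto_iff_dist_tendsto_zero.1 hlim
  have hR := (hd.add ((hd.add (hcons.comp hidx)).const_mul k)).add_const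
    ((1 - k) * setDist A B)
  rw [show 0 + k * (0 + setDist A B) + (1 - k) * setDist A B = setDist A B by ring] at hR
  refine ge_of_tendsto hR ?_
  filter_upwards [eventually_ge_atTop 1] with j hj
  obtain ⟨m, hm⟩ : ∃ m, φ j = m + 1 := Nat.exists_eq_add_of_le' (hj.trans hφ.le_apply)
  simp only [Function.comp_apply, hm, show 2 * (m + 1) = 2 * m + 1 + 1 by ring,
    Nat.add_sub_cancel]
  have h1 := dist_triangle_left z (T z) (x (2 * m + 1 + 1))
  have h2 := hcontr z hz _ (hxB m)
  rw [← hxrec, dist_comm (T z)] at h2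
  have h3 : dist z (x (2 * m + 1)) ≤
      dist (x (2 * m + 1 + 1)) z + dist (x (2 * m + 1)) (x (2 * m + 1 + 1)) := by
    rw [dist_comm (x (2 * m + 1))]
    exact dist_triangle_left _ _ _
  linarith [mul_le_mul_of_nonneg_left h3 hk0]
end

section
/- Let X be a uniformly convex (real) Banach space and let A_1,…,A_p (p ≥ 2, indices modulo p) be nonempty, closed and convex subsets of X with ⋂_{i=1}^p A_i ≠ ∅. Let T : ⋃_i A_i → ⋃_i A_i satisfy T(A_i) ⊆ A_{i+1} for all i and ‖Tx − Ty‖ ≤ K·‖x − y‖ for all x ∈ A_i, y ∈ A_{i+1} and all i, where K ∈ [0,1). Then T has a unique fixed point z, z belongs to ⋂_{i=1}^p A_i, and for every x ∈ ⋃_i A_i the sequence of iterates (T^n x)_{n≥0} converges to z. -/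
open Filter

/-- Intersecting-sets case of Theorem 3.2(i): in a uniformly convex real
Banach space, a contractive `p`-cyclic self-mapping of the union of nonempty
closed convex subsets `A_1, …, A_p` with nonempty intersection has a unique
fixed point `z`, which lies in `⋂ i, A i`, and all sequences of iterates
starting in the union converge to `z`. -/
theorem stmt_17 {X : Type*} [NormedAddCommGroup X] [NormedSpace ℝ X]
    [UniformConvexSpace X] [CompleteSpace X]
    {p : ℕ} (hp : 2 ≤ p) (A : ZMod p → Set X)
    (hAne : ∀ i, (A i).Nonempty) (hAcl : ∀ i, IsClosed (A i)) (hAcv : ∀ i, Convex ℝ (A i))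
    (hint : (⋂ i, A i).Nonempty)
    (T : X → X) (hT : ∀ i : ZMod p, Set.MapsTo T (A i) (A (i + 1)))
    (K : ℝ) (hK0 : 0 ≤ K) (hK1 : K < 1)
    (hcontr : ∀ i : ZMod p, ∀ x ∈ A i, ∀ y ∈ A (i + 1),
      ‖T x - T y‖ ≤ K * ‖x - y‖) :
    ∃ z : X, T z = z ∧ z ∈ ⋂ i, A i ∧
      (∀ w ∈ ⋃ i, A i, T w = w → w = z) ∧
      ∀ x ∈ ⋃ i, A i, Tendsto (fun n => T^[n] x) atTop (nhds z) := by
  have hmaps : Set.MapsTo T (⋂ i, A i) (⋂ i, A i) := by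
    intro x hx
    refine Set.mem_iInter.2 fun j => ?_
    simpa using hT (j - 1) (Set.mem_iInter.1 hx (j - 1))
  have hlip : ContractingWith ⟨K, hK0⟩ (hmaps.restrict T _ _) := by
    refine ⟨by exact_mod_cast hK1, LipschitzWith.of_dist_le_mul fun x y => ?_⟩
    rw [Subtype.dist_eq, Subtype.dist_eq, dist_eq_norm, dist_eq_norm]
    exact
      hcontr 0 x (Set.mem_iInter.1 x.2 0) y (Set.mem_iInter.1 y.2 (0 + 1))
  obtain ⟨x₀, hx₀⟩ := hint
  obtain ⟨z, hz, hTz, -⟩ := hlip.exists_fixedPoint' (isClosed_iInter hAcl).isComplete hmaps hx₀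
    (edist_ne_top _ _)
  have hTz : T z = z := hTz
  have hstep : ∀ i, ∀ x ∈ A i, ‖T x - z‖ ≤ K * ‖x - z‖ := fun i x hx => by
    simpa only [hTz] using hcontr i x hx z (Set.mem_iInter.1 hz (i + 1))
  refine ⟨z, hTz, hz, fun w hw hTw => ?_, fun x hx => ?_⟩
  · obtain ⟨i, hi⟩ := Set.mem_iUnion.1 hw
    have h := hstep i w hi
    rw [hTw] at h
    have h0 : ‖w - z‖ = 0 := by nlinarith [norm_nonneg (w - z)]
    exact sub_eq_zero.1 (norm_eq_zero.1 h0)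
  · have hmem : ∀ n, T^[n] x ∈ ⋃ i, A i := by
      intro n
      induction n with
      | zero => exact hx
      | succ n ih =>
        obtain ⟨i, hi⟩ := Set.mem_iUnion.1 ih
        rw [Function.iterate_succ_apply']
        exact Set.mem_iUnion.2 ⟨i + 1, hT i hi⟩
    have hbound : ∀ n, ‖T^[n] x - z‖ ≤ K ^ n * ‖x - z‖ := by
      intro n
      induction n with
      | zero => simp
      | succ n ih =>
        obtain ⟨i, hi⟩ := Set.mem_iUnion.1 (hmem n)
        rw [Function.iterate_succ_apply', pow_succ', mul_assoc]
        exact (hstep i _ hi).trans (mul_le_mul_of_nonneg_left ih hK0)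
    rw [tendsto_iff_norm_sub_tendsto_zero]
    refine squeeze_zero (fun _ => norm_nonneg _) hbound ?_
    simpa using (tendsto_pow_atTop_nhds_zero_of_lt_one hK0 hK1).mul_const ‖x - z‖
end
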